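/- arXiv:math/0404229 — 3 statements merged into one kernel-verified Lean document; each statement's English description precedes it below -/
import Mathlib

section
/- Let A be an associative unital ring, let V and V′ be A-modules, and suppose σ : V[F_μ] → V′[F_μ] is an A[F_μ]-linear map fitting into an exact sequence 0 → V[F_μ] →^σ V′[F_μ] → M → 0 of A[F_μ]-modules. Then the augmentation ε(σ) : V → V′ is an isomorphism if and only if the A-linear map γ : M^{⊕μ} → M defined by γ(m_1,…,m_μ) = Σ_{i=1}^μ (1−z_i)m_i is an isomorphism. -/
open Finsupp

noncomputable section

/-- The free group `F_μ` on `μ` generators. -/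
abbrev FG (μ : ℕ) : Type := FreeGroup (Fin μ)

/-- The group ring `A[F_μ]`. -/
abbrev GR (μ : ℕ) (A : Type*) [Ring A] : Type _ := MonoidAlgebra A (FG μ)

/-- The augmentation ring homomorphism `ε : A[F_μ] → A` sending every element of `F_μ` to `1`. -/
def aug (μ : ℕ) (A : Type*) [Ring A] : GR μ A →+* A :=
  MonoidAlgebra.liftNCRingHom (RingHom.id A) 1 (fun x y => by simp)


section ExtMod

variable (μ : ℕ) (A : Type*) [Ring A]
variable {V V' : Type*} [AddCommGroup V] [Module A V] [AddCommGroup V'] [Module A V']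

/-- Left translation action of `F_μ` on `V[F_μ] = FG μ →₀ V`. -/
def shiftEnd : FG μ →* AddMonoid.End (FG μ →₀ V) where
  toFun g := Finsupp.mapDomain.addMonoidHom (fun h => g * h)
  map_one' := by
    apply AddMonoidHom.ext
    intro f
    show Finsupp.mapDomain (fun h => (1:FG μ) * h) f = f
    simp only [one_mul]
    exact Finsupp.mapDomain_id
  map_mul' g₁ g₂ := by
    apply AddMonoidHom.ext
    intro f
    show Finsupp.mapDomain (fun h => (g₁ * g₂) * h) f
      = Finsupp.mapDomain (fun h => g₁ * h) (Finsupp.mapDomain (fun h => g₂ * h) f)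
    rw [show (fun h => g₁ * g₂ * h) = (fun h => g₁ * h) ∘ (fun h => g₂ * h) from
      funext fun h => mul_assoc g₁ g₂ h, Finsupp.mapDomain_comp]

/-- The ring homomorphism `A[F_μ] →+* End(V[F_μ])` inducing the module structure on
`V[F_μ] = A[F_μ] ⊗_A V`, realised as `FG μ →₀ V`. -/
def extScalarHom : GR μ A →+* AddMonoid.End (FG μ →₀ V) :=
  MonoidAlgebra.liftNCRingHom (Module.toAddMonoidEnd A (FG μ →₀ V)) (shiftEnd μ)
    (fun a g => by
      apply AddMonoidHom.ext
      intro f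
      show a • (Finsupp.mapDomain _ f) = Finsupp.mapDomain _ (a • f)
      exact (Finsupp.mapDomain_smul a f).symm)

/-- The `A[F_μ]`-module structure on `V[F_μ] = FG μ →₀ V` induced from the `A`-module `V`. -/
instance extModule : Module (GR μ A) (FG μ →₀ V) :=
  Module.compHom (FG μ →₀ V) (extScalarHom μ A (V := V))

/-- The augmentation `ε(σ) : V → V'` of an `A[F_μ]`-linear map `σ : V[F_μ] → V'[F_μ]`,
obtained by applying `A ⊗_{A[F_μ]} -`. -/
def augMap (σ : (FG μ →₀ V) →ₗ[GR μ A] (FG μ →₀ V')) : V → V' :=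
  fun v => (σ (Finsupp.single 1 v)).sum fun _ w => w

end ExtMod

section FoxCalculus

variable {μ : ℕ} {A : Type*} [Ring A]
variable {V V' : Type*} [AddCommGroup V] [Module A V] [AddCommGroup V'] [Module A V']
variable {M N : Type*} [AddCommGroup M] [Module (GR μ A) M] [AddCommGroup N] [Module (GR μ A) N]

theorem of_smul_single (g h : FG μ) (v : V) :
    MonoidAlgebra.of A (FG μ) g • (Finsupp.single h v : FG μ →₀ V) =
      Finsupp.single (g * h) v := by
  change extScalarHom μ A (MonoidAlgebra.single g 1) (Finsupp.single h v) = _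
  have h1 : extScalarHom μ A (V := V) (MonoidAlgebra.single g 1) =
      Module.toAddMonoidEnd A (FG μ →₀ V) 1 * shiftEnd μ g :=
    MonoidAlgebra.liftNC_single _ _ _ _
  rw [h1]
  change (1 : A) • Finsupp.mapDomain (fun k => g * k) (Finsupp.single h v) = _
  rw [one_smul, Finsupp.mapDomain_single]

variable (μ A M) in
/-- The map `γ : M^{⊕μ} → M`, `(m_i) ↦ Σ_i (1 - z_i) m_i`. -/
def satoMap : (Fin μ → M) →+ M where
  toFun m := ∑ i, (m i - (MonoidAlgebra.of A (FG μ) (FreeGroup.of i)) • m i)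
  map_zero' := by simp
  map_add' m n := by
    rw [← Finset.sum_add_distrib]
    refine Finset.sum_congr rfl fun i _ => ?_
    rw [Pi.add_apply, smul_add]
    abel

theorem satoMap_apply (m : Fin μ → M) :
    satoMap μ A M m = ∑ i, (m i - (MonoidAlgebra.of A (FG μ) (FreeGroup.of i)) • m i) := rfl

theorem map_satoMap (f : M →ₗ[GR μ A] N) (m : Fin μ → M) :
    f (satoMap μ A M m) = satoMap μ A N (fun i => f (m i)) := by
  simp only [satoMap_apply, map_sum, map_sub, map_smul]

theorem satoMap_single (i : Fin μ) (m : M) :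
    satoMap μ A M (Pi.single i m) = m - MonoidAlgebra.of A (FG μ) (FreeGroup.of i) • m := by
  rw [satoMap_apply, Finset.sum_eq_single i]
  · simp only [Pi.single_eq_same]
  · intro j _ hj
    rw [Pi.single_eq_of_ne hj, smul_zero, sub_zero]
  · simp

variable (μ V) in
/-- The augmentation `V[F_μ] → V`, summing all coefficients. -/
def coeffSum : (FG μ →₀ V) →+ V :=
  Finsupp.liftAddHom fun _ => AddMonoidHom.id V

@[simp]
theorem coeffSum_single (g : FG μ) (v : V) : coeffSum μ V (Finsupp.single g v) = v := by
  simp [coeffSum]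

theorem augMap_eq (σ : (FG μ →₀ V) →ₗ[GR μ A] (FG μ →₀ V')) (v : V) :
    augMap μ A σ v = coeffSum μ V' (σ (Finsupp.single 1 v)) := rfl

theorem augMap_sub (σ : (FG μ →₀ V) →ₗ[GR μ A] (FG μ →₀ V')) (v w : V) :
    augMap μ A σ (v - w) = augMap μ A σ v - augMap μ A σ w := by
  simp only [augMap_eq, Finsupp.single_sub, map_sub]

theorem coeffSum_of_smul (g : FG μ) (x : FG μ →₀ V) :
    coeffSum μ V (MonoidAlgebra.of A (FG μ) g • x) = coeffSum μ V x := by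
  induction x using Finsupp.induction_linear with
  | zero => rw [smul_zero]
  | add x y hx hy => rw [smul_add, map_add, map_add, hx, hy]
  | single h v => rw [of_smul_single, coeffSum_single, coeffSum_single]

theorem coeffSum_satoMap (m : Fin μ → FG μ →₀ V) :
    coeffSum μ V (satoMap μ A (FG μ →₀ V) m) = 0 := by
  rw [satoMap_apply, map_sum]
  refine Finset.sum_eq_zero fun i _ => ?_
  rw [map_sub, coeffSum_of_smul, sub_self]

theorem coeffSum_map (σ : (FG μ →₀ V) →ₗ[GR μ A] (FG μ →₀ V')) (x : FG μ →₀ V) :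
    coeffSum μ V' (σ x) = augMap μ A σ (coeffSum μ V x) := by
  induction x using Finsupp.induction_linear with
  | zero => simp [augMap_eq]
  | add x y hx hy => rw [map_add, map_add, hx, hy, map_add]; simp [augMap_eq]
  | single g v =>
    rw [coeffSum_single, augMap_eq, ← coeffSum_of_smul (A := A) g (σ (Finsupp.single 1 v)),
      ← map_smul, of_smul_single, mul_one]

variable (μ V) in
/-- The permutation `(w, h) ↦ (w + e_j h, z_j h)`, whose orbits of `(0, 1)` encode the Fox
derivatives. -/
def foxPerm (j : Fin μ) : Equiv.Perm ((Fin μ → V →+ (FG μ →₀ V)) × FG μ) where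
  toFun x := (x.1 + Pi.single j (Finsupp.singleAddHom x.2), FreeGroup.of j * x.2)
  invFun x := (x.1 - Pi.single j (Finsupp.singleAddHom ((FreeGroup.of j)⁻¹ * x.2)),
    (FreeGroup.of j)⁻¹ * x.2)
  left_inv x := by simp
  right_inv x := by simp

variable (V) in
/-- The Fox derivatives of `g : F_μ`, with coefficients in `V`. -/
def foxDeriv (g : FG μ) : Fin μ → V →+ (FG μ →₀ V) :=
  (FreeGroup.lift (foxPerm μ V) g (0, 1)).1

theorem lift_foxPerm_snd (g : FG μ) (x : (Fin μ → V →+ (FG μ →₀ V)) × FG μ) :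
    (FreeGroup.lift (foxPerm μ V) g x).2 = g * x.2 := by
  induction g using FreeGroup.induction_on generalizing x with
  | C1 => simp
  | of j => rw [FreeGroup.lift_apply_of]; rfl
  | inv_of j _ => rw [map_inv, FreeGroup.lift_apply_of]; rfl
  | mul g h hg hh => rw [map_mul, Equiv.Perm.mul_apply, hg, hh, mul_assoc]

theorem foxDeriv_one : foxDeriv V (1 : FG μ) = 0 := by
  rw [foxDeriv, map_one]; rfl

theorem foxDeriv_of_mul (j : Fin μ) (h : FG μ) :
    foxDeriv V (FreeGroup.of j * h) = foxDeriv V h + Pi.single j (Finsupp.singleAddHom h) := by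
  have hs := lift_foxPerm_snd (V := V) h (0, 1)
  rw [mul_one] at hs
  rw [foxDeriv, map_mul, Equiv.Perm.mul_apply, FreeGroup.lift_apply_of]
  change foxDeriv V h + Pi.single (M := fun _ => V →+ (FG μ →₀ V)) j
    (Finsupp.singleAddHom (FreeGroup.lift (foxPerm μ V) h (0, 1)).2) = _
  rw [hs]

/-- Induction on a free group by left multiplication with generators. -/
theorem FreeGroup.induction_of_mul_iff {α : Type*} {P : FreeGroup α → Prop} (one : P 1)
    (of_mul : ∀ a h, P (FreeGroup.of a * h) ↔ P h) (g : FreeGroup α) : P g := by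
  have key : ∀ h, P (g * h) ↔ P h := by
    induction g using FreeGroup.induction_on with
    | C1 => simp
    | of a => exact of_mul a
    | inv_of a _ => intro h; rw [← of_mul a, mul_inv_cancel_left]
    | mul x y hx hy => intro h; rw [mul_assoc, hx, hy]
  simpa using (key 1).2 one

/-- The fundamental formula of Fox calculus. -/
theorem satoMap_foxDeriv (g : FG μ) (v : V) :
    satoMap μ A (FG μ →₀ V) (fun i => foxDeriv V g i v) =
      Finsupp.single 1 v - Finsupp.single g v := by
  induction g using FreeGroup.induction_of_mul_iff with
  | one =>
    rw [foxDeriv_one, sub_self]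
    exact map_zero _
  | of_mul j h =>
    have hsplit : (fun i => foxDeriv V (FreeGroup.of j * h) i v) =
        (fun i => foxDeriv V h i v) + Pi.single j (Finsupp.single h v) := by
      funext i
      rw [foxDeriv_of_mul]
      by_cases hij : i = j
      · subst hij; simp
      · simp [hij]
    rw [hsplit, map_add, satoMap_single, of_smul_single, ← eq_sub_iff_add_eq]
    abel_nf

variable (μ V) in
/-- The total Fox derivative `V[F_μ] → V[F_μ]^{⊕μ}`. -/
def foxMap : (FG μ →₀ V) →+ (Fin μ → FG μ →₀ V) :=
  AddMonoidHom.pi fun i => Finsupp.liftAddHom fun g => foxDeriv V g i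

theorem foxMap_single (g : FG μ) (v : V) :
    foxMap μ V (Finsupp.single g v) = fun i => foxDeriv V g i v := by
  funext i
  exact Finsupp.liftAddHom_apply_single (fun g => foxDeriv V g i) g v

theorem satoMap_foxMap (x : FG μ →₀ V) :
    satoMap μ A (FG μ →₀ V) (foxMap μ V x) = Finsupp.single 1 (coeffSum μ V x) - x := by
  induction x using Finsupp.induction_linear with
  | zero => simp
  | add x y hx hy => rw [map_add, map_add, hx, hy, map_add, Finsupp.single_add]; abel
  | single g v => rw [foxMap_single, satoMap_foxDeriv, coeffSum_single]

theorem foxMap_sub_of_smul (j : Fin μ) (x : FG μ →₀ V) :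
    foxMap μ V (x - MonoidAlgebra.of A (FG μ) (FreeGroup.of j) • x) = -Pi.single j x := by
  induction x using Finsupp.induction_linear with
  | zero => rw [smul_zero, sub_zero, map_zero, Pi.single_zero, neg_zero]
  | add x y hx hy => rw [smul_add, add_sub_add_comm, map_add, hx, hy, Pi.single_add, neg_add]
  | single g v =>
    rw [of_smul_single, map_sub, foxMap_single, foxMap_single, foxDeriv_of_mul]
    funext i
    by_cases hij : i = j
    · subst hij; simp
    · simp [hij]

theorem foxMap_satoMap (m : Fin μ → FG μ →₀ V) :
    foxMap μ V (satoMap μ A (FG μ →₀ V) m) = -m := by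
  rw [satoMap_apply, map_sum]
  simp only [foxMap_sub_of_smul]
  rw [Finset.sum_neg_distrib, Finset.univ_sum_single]

theorem satoMap_injective : Function.Injective (satoMap μ A (FG μ →₀ V)) := fun m n h =>
  neg_injective (by rw [← foxMap_satoMap (A := A), h, foxMap_satoMap])

theorem exists_satoMap_eq {x : FG μ →₀ V} (hx : coeffSum μ V x = 0) :
    ∃ m, satoMap μ A (FG μ →₀ V) m = x :=
  ⟨-foxMap μ V x, by rw [map_neg, satoMap_foxMap, hx, Finsupp.single_zero, zero_sub, neg_neg]⟩

end FoxCalculus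

/-- Sato's criterion. Given an exact sequence
`0 → V[F_μ] →^σ V'[F_μ] →^p M → 0` of `A[F_μ]`-modules, the augmentation `ε(σ) : V → V'`
is an isomorphism if and only if `γ : M^{⊕μ} → M`, `(m_i) ↦ Σ_i (1 − z_i)·m_i`, is an
isomorphism. -/
theorem statement0 (μ : ℕ) (hμ : 0 < μ) (A : Type*) [Ring A]
    (V V' : Type*) [AddCommGroup V] [Module A V] [AddCommGroup V'] [Module A V']
    (M : Type*) [AddCommGroup M] [Module (GR μ A) M]
    (σ : (FG μ →₀ V) →ₗ[GR μ A] (FG μ →₀ V'))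
    (p : (FG μ →₀ V') →ₗ[GR μ A] M)
    (hinj : Function.Injective σ) (hsurj : Function.Surjective p)
    (hexact : LinearMap.range σ = LinearMap.ker p) :
    Function.Bijective (augMap μ A σ) ↔
      Function.Bijective (fun m : Fin μ → M =>
        ∑ i, (m i - (MonoidAlgebra.of A (FG μ) (FreeGroup.of i)) • m i)) := by
  have hpσ : ∀ x, p (σ x) = 0 := fun x =>
    LinearMap.mem_ker.1 (hexact ▸ LinearMap.mem_range_self σ x)
  have hlift : ∀ y, p y = 0 → ∃ x, σ x = y := fun y hy =>
    LinearMap.mem_range.1 (hexact ▸ LinearMap.mem_ker.2 hy)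
  have haug0 : augMap μ A σ 0 = 0 := by simp [augMap_eq]
  change _ ↔ Function.Bijective (satoMap μ A M)
  constructor
  · rintro ⟨finj, fsurj⟩
    refine ⟨(injective_iff_map_eq_zero _).2 fun m hm => ?_, fun m => ?_⟩
    · choose m' hm' using fun i => hsurj (m i)
      obtain rfl : (fun i => p (m' i)) = m := funext hm'
      rw [← map_satoMap] at hm
      obtain ⟨x, hx⟩ := hlift _ hm
      have hx0 : coeffSum μ V x = 0 := finj (by
        rw [← coeffSum_map, hx, coeffSum_satoMap, haug0])
      obtain ⟨w, rfl⟩ := exists_satoMap_eq (A := A) hx0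
      rw [map_satoMap] at hx
      rw [← satoMap_injective hx]
      exact funext fun i => hpσ (w i)
    · obtain ⟨y, rfl⟩ := hsurj m
      obtain ⟨v, hv⟩ := fsurj (coeffSum μ V' y)
      have h0 : coeffSum μ V' (y - σ (Finsupp.single 1 v)) = 0 := by
        rw [map_sub, ← augMap_eq, hv, sub_self]
      obtain ⟨w, hw⟩ := exists_satoMap_eq (A := A) h0
      exact ⟨fun i => p (w i), by rw [← map_satoMap, hw, map_sub, hpσ, sub_zero]⟩
  · rintro ⟨ginj, gsurj⟩
    refine ⟨fun v₁ v₂ hv => ?_, fun v' => ?_⟩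
    · rw [← sub_eq_zero, ← augMap_sub, augMap_eq] at hv
      obtain ⟨w, hw⟩ := exists_satoMap_eq (A := A) hv
      have hpw : (fun i => p (w i)) = 0 := ginj (by
        rw [← map_satoMap, hw, hpσ, map_zero])
      choose x hx using fun i => hlift (w i) (congrFun hpw i)
      obtain rfl : (fun i => σ (x i)) = w := funext hx
      rw [← map_satoMap] at hw
      have h := congrArg (coeffSum μ V) (hinj hw)
      rw [coeffSum_satoMap, coeffSum_single] at h
      exact sub_eq_zero.1 h.symm
    · obtain ⟨m, hm⟩ := gsurj (p (Finsupp.single 1 v'))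
      choose m' hm' using fun i => hsurj (m i)
      obtain rfl : (fun i => p (m' i)) = m := funext hm'
      rw [← map_satoMap] at hm
      obtain ⟨x, hx⟩ := hlift (Finsupp.single 1 v' - satoMap μ A _ m') (by
        rw [map_sub, hm, sub_self])
      exact ⟨coeffSum μ V x, by
        rw [← coeffSum_map, hx, map_sub, coeffSum_single, coeffSum_satoMap, sub_zero]⟩
end
end

section
/- Let A be an associative unital ring and V any A-module. Then the intersection ⋂_{n≥0} I^n·V[F_μ] of the A[F_μ]-submodules I^n·V[F_μ] ⊆ V[F_μ] is zero; consequently the canonical map from V[F_μ] to the inverse limit lim_n V[F_μ]/(I^n·V[F_μ]) is injective. -/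
open Finsupp

noncomputable section

/-- The chain of submodules `I^n·V[F_μ] ⊆ V[F_μ]`, where `I = ker ε` is the augmentation
ideal of `A[F_μ]`. -/
def Ipow (μ : ℕ) (A : Type*) [Ring A] (V : Type*) [AddCommGroup V] [Module A V] :
    ℕ → Submodule (GR μ A) (FG μ →₀ V)
  | 0 => ⊤
  | n + 1 => Submodule.span (GR μ A)
      {x | ∃ a ∈ RingHom.ker (aug μ A), ∃ y ∈ Ipow μ A V n, x = a • y}

section FoxDerivative

variable {α : Type*} {A V : Type*} [Ring A] [AddCommGroup V] [Module A V]

theorem FreeGroup.IsReduced.toWord_mk [DecidableEq α] {L : List (α × Bool)}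
    (h : FreeGroup.IsReduced L) : (FreeGroup.mk L).toWord = L := by
  rw [FreeGroup.toWord_mk, h.reduce_eq]

variable [DecidableEq α]

/-- The Fox derivative with respect to the `i`-th generator of `v` times the group element
represented by a word. -/
def foxWord (A : Type*) {V : Type*} [Ring A] [AddCommGroup V] [Module A V] (i : α) :
    List (α × Bool) → V →ₗ[A] (FreeGroup α →₀ V)
  | [] => 0
  | (j, b) :: L => (foxWord A i L : V →ₗ[A] (FreeGroup α →₀ V)) + if i = j then
      (if b then Finsupp.lsingle (FreeGroup.mk L)
        else -Finsupp.lsingle (FreeGroup.mk ((j, b) :: L))) else 0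

theorem foxWord_step (i : α) {L L' : List (α × Bool)} (h : FreeGroup.Red.Step L L') :
    foxWord A (V := V) i L = foxWord A i L' := by
  obtain @⟨L₁, L₂, x, b⟩ := h
  induction L₁ with
  | nil =>
    have e : FreeGroup.mk ((x, false) :: (x, true) :: L₂) = FreeGroup.mk L₂ :=
      Quot.sound FreeGroup.Red.Step.cons_not
    cases b <;> by_cases hx : i = x <;> simp [foxWord, hx, e]
  | cons p L₁ ih =>
    obtain ⟨j, c⟩ := p
    have h₀ : FreeGroup.Red.Step (L₁ ++ (x, b) :: (x, !b) :: L₂) (L₁ ++ L₂) := .not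
    have e₁ : FreeGroup.mk (L₁ ++ (x, b) :: (x, !b) :: L₂) = FreeGroup.mk (L₁ ++ L₂) :=
      Quot.sound h₀
    have e₂ : FreeGroup.mk ((j, c) :: (L₁ ++ (x, b) :: (x, !b) :: L₂)) =
        FreeGroup.mk ((j, c) :: (L₁ ++ L₂)) := Quot.sound h₀.cons
    simp only [List.cons_append, foxWord, ih, e₁, e₂]

theorem foxWord_toWord_mk (i : α) (L : List (α × Bool)) :
    foxWord A (V := V) i (FreeGroup.mk L).toWord = foxWord A i L := by
  have key : ∀ {L L' : List (α × Bool)}, FreeGroup.Red L L' →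
      foxWord A (V := V) i L = foxWord A i L' := by
    intro L L' h
    induction h with
    | refl => rfl
    | tail _ h ih => rw [ih, foxWord_step i h]
  rw [FreeGroup.toWord_mk, ← key FreeGroup.reduce.red]

theorem foxWord_apply (i : α) {L : List (α × Bool)} (hL : FreeGroup.IsReduced L) (v : V)
    (h : FreeGroup α) :
    foxWord A i L v h = (if (i, true) :: h.toWord <:+ L then v else 0) -
      if h.toWord.head? = some (i, false) ∧ h.toWord <:+ L then v else 0 := by
  induction L with
  | nil =>
    have : ¬ (h.toWord.head? = some (i, false) ∧ h.toWord <:+ []) := by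
      rintro ⟨h₁, h₂⟩
      simp_all
    rw [if_neg this]
    simp [foxWord]
  | cons p L ih =>
    obtain ⟨j, b⟩ := p
    have hL' : FreeGroup.IsReduced L := hL.infix (List.suffix_cons _ _).isInfix
    have e₁ : FreeGroup.mk L = h ↔ h.toWord = L := by
      rw [← FreeGroup.toWord_inj, hL'.toWord_mk, eq_comm]
    have e₂ : FreeGroup.mk ((j, b) :: L) = h ↔ h.toWord = (j, b) :: L := by
      rw [← FreeGroup.toWord_inj, hL.toWord_mk, eq_comm]
    have n₁ : h.toWord = L → ¬ (i, true) :: h.toWord <:+ L := fun e s => by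
      have := s.length_le
      simp [e] at this
    have n₂ : h.toWord = (j, b) :: L → ¬ h.toWord <:+ L := fun e s => by
      have := s.length_le
      simp [e] at this
    simp only [foxWord, LinearMap.add_apply, Finsupp.add_apply, ih hL', List.suffix_cons_iff,
      List.cons.injEq, Prod.mk.injEq]
    by_cases hij : i = j
    · subst hij
      cases b
      · by_cases hw : h.toWord = (i, false) :: L
        · have := n₂ hw
          simp [Finsupp.single_apply, e₂, hw] at *
          simp [this, sub_eq_add_neg]
        · simp [e₂, hw]
      · by_cases hw : h.toWord = L
        · have := n₁ hw
          have : h.toWord ≠ (i, true) :: L := by simp [hw]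
          simp_all
          abel
        · have : h.toWord.head? = some (i, false) → h.toWord ≠ (i, true) :: L := by
            rintro h₁ h₂
            simp [h₂] at h₁
          simp [e₁, hw]
          grind
    · have : h.toWord.head? = some (i, false) → h.toWord ≠ (j, b) :: L := by
        rintro h₁ h₂
        simp [h₂] at h₁
        exact hij h₁.1.symm
      simp [hij]
      grind

/-- The left Fox derivative with respect to the `i`-th generator. -/
def fox (A : Type*) {V : Type*} [Ring A] [AddCommGroup V] [Module A V] (i : α) :
    (FreeGroup α →₀ V) →ₗ[A] (FreeGroup α →₀ V) :=
  Finsupp.lsum ℕ fun g => foxWord A i g.toWord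

theorem fox_single (i : α) (g : FreeGroup α) (v : V) :
    fox A i (Finsupp.single g v) = foxWord A i g.toWord v := by
  simp [fox]

theorem fox_apply (i : α) (x : FreeGroup α →₀ V) (h : FreeGroup α) :
    fox A i x h = x.sum fun g v => (if (i, true) :: h.toWord <:+ g.toWord then v else 0) -
      if h.toWord.head? = some (i, false) ∧ h.toWord <:+ g.toWord then v else 0 := by
  rw [fox, Finsupp.lsum_apply, Finsupp.sum, Finsupp.finsetSum_apply]
  exact Finset.sum_congr rfl fun g _ => foxWord_apply i FreeGroup.isReduced_toWord _ _

theorem fox_mapDomain_of_mul (i j : α) (y : FreeGroup α →₀ V) :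
    fox A i (y.mapDomain (FreeGroup.of j * ·)) = (if i = j then y else 0) + fox A i y := by
  induction y using Finsupp.induction_linear with
  | zero => simp
  | add x y hx hy =>
    rw [Finsupp.mapDomain_add, map_add, hx, hy, map_add]
    split_ifs <;> abel
  | single g v =>
    have e : FreeGroup.of j * g = FreeGroup.mk ((j, true) :: g.toWord) := by
      conv_lhs => rw [← FreeGroup.mk_toWord (x := g)]
      rfl
    rw [Finsupp.mapDomain_single, e, fox_single, fox_single, foxWord_toWord_mk, foxWord,
      FreeGroup.mk_toWord]
    by_cases hij : i = j <;> simp [hij, add_comm]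

/-- A subset of the words containing the support of `x` and closed under suffixes also contains
the support of the Fox derivatives of `x` and of their translates by the generator. -/
theorem mem_of_fox_ne_zero {T : Set (List (α × Bool))}
    (hT : ∀ L ∈ T, ∀ L', L' <:+ L → L' ∈ T) {x : FreeGroup α →₀ V}
    (hx : ∀ g, x g ≠ 0 → g.toWord ∈ T) {i : α} {h : FreeGroup α} (hh : fox A i x h ≠ 0) :
    h.toWord ∈ T ∧ (FreeGroup.of i * h).toWord ∈ T := by
  rw [fox_apply] at hh
  obtain ⟨g, hg, hne⟩ := Finset.exists_ne_zero_of_sum_ne_zero hh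
  have hgT := hx g (Finsupp.mem_support_iff.1 hg)
  by_cases h₁ : (i, true) :: h.toWord <:+ g.toWord
  · have hm : (FreeGroup.of i * h).toWord = (i, true) :: h.toWord := by
      have hr : FreeGroup.IsReduced ((i, true) :: h.toWord) :=
        FreeGroup.isReduced_toWord.infix h₁.isInfix
      rw [← hr.toWord_mk]
      conv_lhs => rw [← FreeGroup.mk_toWord (x := h)]
      rfl
    exact ⟨hT _ hgT _ ((List.suffix_cons _ _).trans h₁), hm ▸ hT _ hgT _ h₁⟩
  · by_cases h₂ : h.toWord.head? = some (i, false) ∧ h.toWord <:+ g.toWord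
    · obtain ⟨h₂, h₃⟩ := h₂
      obtain ⟨L, hL⟩ : ∃ L, h.toWord = (i, false) :: L := by
        cases e : h.toWord with
        | nil => simp [e] at h₂
        | cons p L => exact ⟨L, by simp_all⟩
      have hr : FreeGroup.IsReduced L :=
        (hL ▸ FreeGroup.isReduced_toWord (x := h)).infix (List.suffix_cons _ _).isInfix
      have hm : (FreeGroup.of i * h).toWord = L := by
        conv_rhs => rw [← hr.toWord_mk]
        conv_lhs => rw [← FreeGroup.mk_toWord (x := h), hL]
        exact congrArg FreeGroup.toWord (Quot.sound FreeGroup.Red.Step.cons_not)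
      refine ⟨hT _ hgT _ h₃, hm ▸ hT _ hgT _ (List.IsSuffix.trans ?_ h₃)⟩
      rw [hL]
      exact List.suffix_cons _ _
    · simp only [if_neg h₁, if_neg h₂, sub_zero] at hne
      exact absurd rfl hne

/-- A set of finitely supported functions on the free group is trivial if it consists of functions
with coefficient sum zero and is stable under Fox derivatives and translation by the generators. -/
theorem eq_zero_of_fox_stable (J : Set (FreeGroup α →₀ V))
    (hε : ∀ x ∈ J, (x.sum fun _ v => v) = 0) (hfox : ∀ x ∈ J, ∀ i, fox A i x ∈ J)
    (hmul : ∀ x ∈ J, ∀ i, x.mapDomain (FreeGroup.of i * ·) ∈ J) :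
    ∀ x ∈ J, x = 0 := by
  suffices H : ∀ (n : ℕ) (T : Finset (List (α × Bool))), T.card = n →
      (∀ L ∈ T, ∀ L', L' <:+ L → L' ∈ T) →
      ∀ x ∈ J, (∀ g, x g ≠ 0 → g.toWord ∈ T) → x = 0 by
    intro x hx
    refine H _ (x.support.biUnion fun g => g.toWord.tails.toFinset) rfl ?_ x hx ?_
    · intro L hL L' hs
      simp only [Finset.mem_biUnion, List.mem_toFinset, List.mem_tails] at hL ⊢
      obtain ⟨g, hg, hgL⟩ := hL
      exact ⟨g, hg, hs.trans hgL⟩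
    · intro g hg
      simp only [Finset.mem_biUnion, List.mem_toFinset, List.mem_tails]
      exact ⟨g, Finsupp.mem_support_iff.2 hg, List.suffix_refl _⟩
  intro n
  induction n with
  | zero =>
    intro T hT _ x _ hxT
    rw [Finset.card_eq_zero] at hT
    ext g
    by_contra hg
    simpa [hT] using hxT g hg
  | succ n ih =>
    intro T hcard hT x hx hxT
    obtain ⟨u, hu, hmax⟩ := T.exists_max_image List.length
      (Finset.card_pos.1 (by omega))
    have hstep : ∀ y ∈ J, (∀ g, y g ≠ 0 → g.toWord ∈ T ∧ g.toWord ≠ u) → y = 0 := by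
      intro y hy hyT
      refine ih (T.erase u) (by rw [Finset.card_erase_of_mem hu]; omega) ?_ y hy
        fun g hg => Finset.mem_erase.2 (hyT g hg).symm
      intro L hL L' hs
      obtain ⟨hLu, hLT⟩ := Finset.mem_erase.1 hL
      refine Finset.mem_erase.2 ⟨?_, hT L hLT L' hs⟩
      rintro rfl
      exact hLu (hs.eq_of_length_le (hmax L hLT)).symm
    by_cases hxu : ∀ g, g.toWord = u → x g = 0
    · exact hstep x hx fun g hg => ⟨hxT g hg, fun e => hg (hxu g e)⟩
    push Not at hxu
    obtain ⟨g, rfl, hg⟩ := hxu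
    exfalso
    have hlen : ∀ h, x h ≠ 0 → h.toWord.length ≤ g.toWord.length := fun h hh => hmax _ (hxT h hh)
    have hsuff : ∀ h, x h ≠ 0 → (g.toWord <:+ h.toWord ↔ h = g) := fun h hh =>
      ⟨fun hs => (FreeGroup.toWord_inj.1 (hs.eq_of_length_le (hlen h hh))).symm,
        fun e => e ▸ List.suffix_refl _⟩
    have hlong : ∀ h, x h ≠ 0 → ∀ p, ¬ p :: g.toWord <:+ h.toWord := fun h hh p hs => by
      have h₁ := hs.length_le
      have h₂ := hlen h hh
      simp at h₁
      omega
    have hred : FreeGroup.IsReduced g.toWord := FreeGroup.isReduced_toWord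
    have hmem : ∀ i h, fox A i x h ≠ 0 → h.toWord ∈ T ∧ (FreeGroup.of i * h).toWord ∈ T :=
      fun i h => mem_of_fox_ne_zero (T := (T : Set (List (α × Bool)))) hT hxT
    cases e : g.toWord with
    | nil =>
      have hg1 : ∀ h, x h ≠ 0 → h = g := fun h hh => by
        have := hlen h hh
        rw [← FreeGroup.toWord_inj, e]
        simpa [e] using this
      have := hε x hx
      rw [Finsupp.sum, Finset.sum_eq_single g (fun h hh hne =>
        absurd (hg1 h (Finsupp.mem_support_iff.1 hh)) hne) (by simp)] at this
      exact hg this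
    | cons p L =>
      obtain ⟨i, b⟩ := p
      have hredL : FreeGroup.IsReduced L :=
        (e ▸ hred).infix (List.suffix_cons _ _).isInfix
      cases b
      · have hy0 : (fox A i x).mapDomain (FreeGroup.of i * ·) = 0 := by
          refine hstep _ (hmul _ (hfox x hx i) i) fun h hh => ?_
          obtain ⟨k, rfl⟩ : ∃ k, h = FreeGroup.of i * k := ⟨(FreeGroup.of i)⁻¹ * h, by simp⟩
          rw [Finsupp.mapDomain_apply (mul_right_injective _)] at hh
          refine ⟨(hmem i k hh).2, fun hk => ?_⟩
          have hk' : k.toWord = (i, false) :: g.toWord := by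
            have hr : FreeGroup.IsReduced ((i, false) :: g.toWord) := by
              rw [e, FreeGroup.isReduced_cons_cons]
              exact ⟨fun _ => rfl, e ▸ hred⟩
            rw [← hr.toWord_mk, FreeGroup.toWord_inj, eq_comm]
            have : FreeGroup.mk ((i, false) :: g.toWord) = (FreeGroup.of i)⁻¹ * g := by
              conv_rhs => rw [← FreeGroup.mk_toWord (x := g)]
              rfl
            rw [this, ← FreeGroup.toWord_inj.1 hk, inv_mul_cancel_left]
          have := hmax _ (hmem i k hh).1
          simp [hk'] at this
        have hf0 : fox A i x = 0 := by
          refine Finsupp.mapDomain_injective (mul_right_injective (FreeGroup.of i)) ?_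
          rw [hy0, Finsupp.mapDomain_zero]
        have := DFunLike.congr_fun hf0 g
        rw [fox_apply, Finsupp.sum, Finset.sum_eq_single g] at this
        · rw [if_neg (hlong g hg _), if_pos ⟨by simp [e], List.suffix_refl _⟩] at this
          simp at this
          exact hg this
        · intro h hh hne
          have hh := Finsupp.mem_support_iff.1 hh
          rw [if_neg (hlong h hh _), if_neg fun H => hne ((hsuff h hh).1 H.2), sub_zero]
        · exact fun h => absurd (Finsupp.mem_support_iff.2 hg) h
      · have hf0 : fox A i x = 0 := by
          refine hstep _ (hfox x hx i) fun h hh => ⟨(hmem i h hh).1, fun hk => hh ?_⟩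
          rw [FreeGroup.toWord_inj.1 hk, fox_apply]
          refine Finset.sum_eq_zero fun k hk => ?_
          have hk := Finsupp.mem_support_iff.1 hk
          beta_reduce
          rw [if_neg (hlong k hk _), if_neg (by simp [e]), sub_zero]
        have := DFunLike.congr_fun hf0 (FreeGroup.mk L)
        have hhead : ¬ L.head? = some (i, false) := by
          intro hL
          cases L with
          | nil => simp at hL
          | cons q L =>
            rw [e, FreeGroup.isReduced_cons_cons] at hred
            simp at hL
            simpa [hL] using hred.1
        rw [fox_apply, hredL.toWord_mk, ← e, Finsupp.sum, Finset.sum_eq_single g] at this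
        · rw [if_pos (List.suffix_refl _), if_neg fun H => hhead H.1, sub_zero] at this
          exact hg this
        · intro h hh hne
          have hh := Finsupp.mem_support_iff.1 hh
          rw [if_neg fun H => hne ((hsuff h hh).1 H), if_neg fun H => hhead H.1, sub_zero]
        · exact fun h => absurd (Finsupp.mem_support_iff.2 hg) h

end FoxDerivative

section Filtration

variable {μ : ℕ} {A : Type*} [Ring A] {V : Type*} [AddCommGroup V] [Module A V]

theorem monoidAlgebra_single_smul (g : FG μ) (a : A) (y : FG μ →₀ V) :
    (MonoidAlgebra.single g a : GR μ A) • y = a • y.mapDomain (g * ·) := by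
  change extScalarHom μ A (MonoidAlgebra.single g a) y = _
  exact DFunLike.congr_fun (MonoidAlgebra.liftNCRingHom_single _ _ _ _ _) y

theorem aug_single (g : FG μ) (a : A) : aug μ A (MonoidAlgebra.single g a) = a := by
  simp [aug]

/-- The crossed product rule for the Fox derivatives. -/
theorem exists_fox_smul (i : Fin μ) (a : GR μ A) :
    ∃ b : GR μ A, ∀ y : FG μ →₀ V, fox A i (a • y) = b • y + aug μ A a • fox A i y := by
  have hmul : ∀ a a' : GR μ A,
      (∃ b : GR μ A, ∀ y : FG μ →₀ V, fox A i (a • y) = b • y + aug μ A a • fox A i y) →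
      (∃ b : GR μ A, ∀ y : FG μ →₀ V, fox A i (a' • y) = b • y + aug μ A a' • fox A i y) →
      ∃ b : GR μ A, ∀ y : FG μ →₀ V,
        fox A i ((a * a') • y) = b • y + aug μ A (a * a') • fox A i y := by
    rintro a a' ⟨b, hb⟩ ⟨b', hb'⟩
    refine ⟨b * a' + MonoidAlgebra.single 1 (aug μ A a) * b', fun y => ?_⟩
    have h1 : ∀ z : FG μ →₀ V, (MonoidAlgebra.single 1 (aug μ A a) : GR μ A) • z =
        aug μ A a • z := fun z => by
      rw [monoidAlgebra_single_smul]
      simp only [one_mul]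
      rw [show (fun h : FG μ => h) = id from rfl, Finsupp.mapDomain_id]
    rw [mul_smul, hb, hb', add_smul, mul_smul, mul_smul, h1, map_mul, smul_add, mul_smul,
      add_assoc]
  have hof : ∀ j : Fin μ, ∀ y : FG μ →₀ V,
      fox A i ((MonoidAlgebra.single (FreeGroup.of j) 1 : GR μ A) • y) =
        (if i = j then y else 0) + fox A i y := fun j y => by
    rw [monoidAlgebra_single_smul, one_smul, fox_mapDomain_of_mul]
  have hgrp : ∀ g : FG μ, ∃ b : GR μ A, ∀ y : FG μ →₀ V,
      fox A i ((MonoidAlgebra.single g 1 : GR μ A) • y) =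
        b • y + aug μ A (MonoidAlgebra.single g 1) • fox A i y := by
    intro g
    induction g using FreeGroup.induction_on with
    | C1 => exact ⟨0, fun y => by
        rw [← MonoidAlgebra.one_def, one_smul, map_one, one_smul, zero_smul, zero_add]⟩
    | of j =>
      refine ⟨if i = j then 1 else 0, fun y => ?_⟩
      rw [hof, aug_single, one_smul]
      split_ifs <;> simp
    | inv_of j _ =>
      refine ⟨if i = j then -MonoidAlgebra.single (FreeGroup.of j)⁻¹ 1 else 0, fun y => ?_⟩
      have := hof j ((MonoidAlgebra.single (FreeGroup.of j)⁻¹ 1 : GR μ A) • y)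
      rw [← mul_smul, MonoidAlgebra.single_mul_single, mul_inv_cancel, one_mul,
        ← MonoidAlgebra.one_def, one_smul] at this
      rw [aug_single, one_smul, this]
      split_ifs <;> simp
    | mul g h hg hh =>
      have := hmul _ _ hg hh
      rwa [MonoidAlgebra.single_mul_single, one_mul] at this
  induction a using MonoidAlgebra.induction_linear with
  | zero => exact ⟨0, fun y => by simp⟩
  | add a a' h h' =>
    obtain ⟨b, hb⟩ := h
    obtain ⟨b', hb'⟩ := h'
    refine ⟨b + b', fun y => ?_⟩
    rw [add_smul, map_add, hb, hb', map_add, add_smul, add_smul]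
    abel
  | single g c =>
    have hc : ∃ b : GR μ A, ∀ y : FG μ →₀ V,
        fox A i ((MonoidAlgebra.single 1 c : GR μ A) • y) =
          b • y + aug μ A (MonoidAlgebra.single 1 c) • fox A i y := by
      refine ⟨0, fun y => ?_⟩
      rw [monoidAlgebra_single_smul, aug_single, zero_smul, zero_add]
      simp only [one_mul]
      rw [show (fun h : FG μ => h) = id from rfl, Finsupp.mapDomain_id, map_smul]
    have := hmul _ _ hc (hgrp g)
    rwa [MonoidAlgebra.single_mul_single, one_mul, mul_one] at this

theorem fox_mem_Ipow (i : Fin μ) (n : ℕ) {x : FG μ →₀ V} (hx : x ∈ Ipow μ A V (n + 1)) :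
    fox A i x ∈ Ipow μ A V n := by
  suffices H : ∀ r : GR μ A, fox A i (r • x) ∈ Ipow μ A V n by simpa using H 1
  rw [Ipow] at hx
  induction hx using Submodule.span_induction with
  | mem x hx =>
    intro r
    obtain ⟨a, ha, y, hy, rfl⟩ := hx
    obtain ⟨b, hb⟩ := exists_fox_smul (V := V) i (r * a)
    rw [← mul_smul, hb, map_mul, (RingHom.mem_ker).1 ha, mul_zero, zero_smul, add_zero]
    exact Submodule.smul_mem _ _ hy
  | zero => simp
  | add x y _ _ hx hy =>
    intro r
    rw [smul_add, map_add]
    exact add_mem (hx r) (hy r)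
  | smul s x _ hx =>
    intro r
    rw [← mul_smul]
    exact hx _

theorem sum_eq_zero_of_mem_Ipow_one {x : FG μ →₀ V} (hx : x ∈ Ipow μ A V 1) :
    (x.sum fun _ v => v) = 0 := by
  let e : (FG μ →₀ V) →ₗ[A] V := Finsupp.lsum ℕ fun _ => LinearMap.id
  have he : ∀ (a : GR μ A) (y : FG μ →₀ V), e (a • y) = aug μ A a • e y := by
    intro a y
    induction a using MonoidAlgebra.induction_linear with
    | zero => simp
    | add a a' h h' => rw [add_smul, map_add, h, h', map_add, add_smul]
    | single g c =>
      rw [monoidAlgebra_single_smul, aug_single, map_smul]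
      congr 1
      exact Finsupp.sum_mapDomain_index (by simp) (by simp)
  change e x = 0
  rw [Ipow] at hx
  induction hx using Submodule.span_induction with
  | mem x hx =>
    obtain ⟨a, ha, y, -, rfl⟩ := hx
    rw [he, (RingHom.mem_ker).1 ha, zero_smul]
  | zero => simp
  | add x y _ _ hx hy => rw [map_add, hx, hy, add_zero]
  | smul s x _ hx => rw [he, hx, smul_zero]

end Filtration

/-- For any `A`-module `V`, the intersection `⋂_{n≥0} I^n·V[F_μ]` is zero;
consequently the canonical map from `V[F_μ]` to the inverse limit of the quotients
`V[F_μ]/(I^n·V[F_μ])` is injective. -/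
theorem statement2 (μ : ℕ) (A : Type*) [Ring A] (V : Type*) [AddCommGroup V] [Module A V] :
    (⨅ n : ℕ, Ipow μ A V n) = ⊥ ∧
    Function.Injective (fun (x : FG μ →₀ V) =>
      (fun n : ℕ => (Submodule.Quotient.mk x : (FG μ →₀ V) ⧸ Ipow μ A V n))) := by
  have key : ∀ x ∈ ⨅ n : ℕ, Ipow μ A V n, x = 0 := by
    refine eq_zero_of_fox_stable (A := A)
      {x : FG μ →₀ V | x ∈ ⨅ n : ℕ, Ipow μ A V n} ?_ ?_ ?_ <;>
      simp only [Set.mem_ofPred_eq]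
    · exact fun x hx => sum_eq_zero_of_mem_Ipow_one ((Submodule.mem_iInf _).1 hx 1)
    · exact fun x hx i => (Submodule.mem_iInf _).2 fun n =>
        fox_mem_Ipow i n ((Submodule.mem_iInf _).1 hx (n + 1))
    · intro x hx i
      have := Submodule.smul_mem _ (MonoidAlgebra.single (FreeGroup.of i) 1 : GR μ A) hx
      rwa [monoidAlgebra_single_smul, one_smul] at this
  refine ⟨(Submodule.eq_bot_iff _).2 key, fun x y hxy => sub_eq_zero.1 (key _ ?_)⟩
  exact (Submodule.mem_iInf _).2 fun n => (Submodule.Quotient.eq _).1 (congrFun hxy n)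
end
end

section
/- Let k be a field and let f : M → M′ be a k[F_μ]-linear map between F_μ-link modules M, M′ ∈ Flk(k). Then ker(f), im(f) and coker(f) are again F_μ-link modules in Flk(k). (Together with closure under finite direct sums, this shows Flk(k) is an abelian category.) -/
open Finsupp

noncomputable section

/-- The augmentation `ε(σ) : A^n → A^n` of an `A[F_μ]`-linear endomorphism `σ` of
`(A[F_μ])^n`. -/
def augPi (μ : ℕ) (A : Type*) [Ring A] {n : ℕ}
    (σ : (Fin n → GR μ A) →ₗ[GR μ A] (Fin n → GR μ A)) : (Fin n → A) → (Fin n → A) :=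
  fun v j => aug μ A (σ (fun i => MonoidAlgebra.single 1 (v i)) j)

/-- `M` is an `F_μ`-link module over the field `k` (`M ∈ Flk(k)`): there are `n ≥ 0` and an
exact sequence `0 → (k[F_μ])^n →^σ (k[F_μ])^n → M → 0` with `ε(σ) : k^n → k^n` invertible. -/
def IsFlkField (μ : ℕ) (k : Type*) [Field k] (M : Type*) [AddCommGroup M]
    [Module (GR μ k) M] : Prop :=
  ∃ (n : ℕ) (σ : (Fin n → GR μ k) →ₗ[GR μ k] (Fin n → GR μ k))
    (p : (Fin n → GR μ k) →ₗ[GR μ k] M),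
      Function.Injective σ ∧ Function.Surjective p ∧ LinearMap.range σ = LinearMap.ker p ∧
      Function.Bijective (augPi μ k σ)



namespace FreeGroupRing

open MonoidAlgebra

variable {μ : ℕ} {k : Type*} [Field k]

/-- The element `z_i` of the group ring. -/
def gen (k : Type*) [Field k] (i : Fin μ) : GR μ k := of k (FG μ) (FreeGroup.of i)

/-- The element `z_i⁻¹` of the group ring. -/
def genInv (k : Type*) [Field k] (i : Fin μ) : GR μ k := of k (FG μ) (FreeGroup.of i)⁻¹

@[simp]
theorem gen_mul_genInv (i : Fin μ) : gen k i * genInv k i = 1 := by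
  rw [gen, genInv, ← map_mul, mul_inv_cancel, map_one]

@[simp]
theorem genInv_mul_gen (i : Fin μ) : genInv k i * gen k i = 1 := by
  rw [gen, genInv, ← map_mul, inv_mul_cancel, map_one]

@[simp]
theorem gen_mul_genInv_mul (i : Fin μ) (x : GR μ k) : gen k i * (genInv k i * x) = x := by
  rw [← mul_assoc, gen_mul_genInv, one_mul]

@[simp]
theorem genInv_mul_gen_mul (i : Fin μ) (x : GR μ k) : genInv k i * (gen k i * x) = x := by
  rw [← mul_assoc, genInv_mul_gen, one_mul]

@[simp]
theorem aug_single (g : FG μ) (a : k) : aug μ k (single g a) = a := by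
  simp [aug, liftNCRingHom, liftNC_single]

@[simp]
theorem aug_algebraMap (a : k) : aug μ k (algebraMap k (GR μ k) a) = a := by
  simp

@[simp]
theorem aug_gen (i : Fin μ) : aug μ k (gen k i) = 1 := by
  simp [gen]

theorem aug_smul (a : k) (x : GR μ k) : aug μ k (a • x) = a * aug μ k x := by
  rw [Algebra.smul_def, map_mul, aug_algebraMap]

/-- Every linear property of group ring elements that is inherited by `z_i x` and `z_i⁻¹ x`
and holds for `1` holds everywhere. -/
theorem induction_gen {P : GR μ k → Prop} (x : GR μ k) (one : P 1)
    (add : ∀ x y, P x → P y → P (x + y)) (smul : ∀ (a : k) x, P x → P (a • x))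
    (gen_mul : ∀ i x, P x → P (gen k i * x)) (genInv_mul : ∀ i x, P x → P (genInv k i * x)) :
    P x := by
  refine MonoidAlgebra.induction_on x (fun g => ?_) add smul
  suffices ∀ y, P y → P (of k (FG μ) g * y) by simpa using this 1 one
  induction g using FreeGroup.induction_on with
  | C1 => intro y hy; rwa [map_one, one_mul]
  | of i => exact fun y hy => gen_mul i y hy
  | inv_of i _ => exact fun y hy => genInv_mul i y hy
  | mul g h hg hh =>
    intro y hy
    rw [map_mul, mul_assoc]
    exact hg _ (hh _ hy)

/-- The affine action of `z_j` underlying the Fox derivatives. -/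
def foxUnit (k : Type*) [Field k] (j : Fin μ) :
    (Module.End k ((Fin μ → GR μ k) × GR μ k))ˣ where
  val :=
    { toFun := fun p => (p.1 + Pi.single j p.2, gen k j * p.2)
      map_add' := fun p q => by
        ext1
        · simp only [Prod.fst_add, Prod.snd_add, Pi.single_add]; abel
        · simp [mul_add]
      map_smul' := fun a p => by
        ext1
        · simp [Pi.single_smul]
        · simp }
  inv :=
    { toFun := fun p => (p.1 - Pi.single j (genInv k j * p.2), genInv k j * p.2)
      map_add' := fun p q => by
        ext1
        · simp only [Prod.fst_add, Prod.snd_add, mul_add, Pi.single_add]; abel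
        · simp [mul_add]
      map_smul' := fun a p => by
        ext1
        · simp [Pi.single_smul, smul_sub]
        · simp }
  val_inv := by
    apply LinearMap.ext
    intro p
    simp
  inv_val := by
    apply LinearMap.ext
    intro p
    simp

/-- The algebra homomorphism encoding all Fox derivatives. -/
def foxHom (μ : ℕ) (k : Type*) [Field k] :
    GR μ k →ₐ[k] Module.End k ((Fin μ → GR μ k) × GR μ k) :=
  MonoidAlgebra.lift k _ (FG μ) ((Units.coeHom _).comp (FreeGroup.lift (foxUnit k)))

theorem foxHom_gen (j : Fin μ) (p : (Fin μ → GR μ k) × GR μ k) :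
    foxHom μ k (gen k j) p = (p.1 + Pi.single j p.2, gen k j * p.2) := by
  rw [foxHom, gen, lift_of]
  simp [foxUnit, gen]

theorem foxHom_genInv (j : Fin μ) (p : (Fin μ → GR μ k) × GR μ k) :
    foxHom μ k (genInv k j) p =
      (p.1 - Pi.single j (genInv k j * p.2), genInv k j * p.2) := by
  rw [foxHom, genInv, lift_of]
  simp [foxUnit, genInv]

theorem foxHom_snd (x : GR μ k) (p : (Fin μ → GR μ k) × GR μ k) :
    (foxHom μ k x p).2 = x * p.2 := by
  induction x using induction_gen with
  | one => simp
  | add x y hx hy => simp [hx, hy, add_mul]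
  | smul a x hx => simp [hx]
  | gen_mul i x hx => rw [map_mul, Module.End.mul_apply, foxHom_gen, hx, mul_assoc]
  | genInv_mul i x hx => rw [map_mul, Module.End.mul_apply, foxHom_genInv, hx, mul_assoc]

/-- The `i`-th Fox derivative. -/
def fox (i : Fin μ) : GR μ k →ₗ[k] GR μ k where
  toFun x := (foxHom μ k x (0, 1)).1 i
  map_add' x y := by simp
  map_smul' a x := by simp

@[simp]
theorem fox_one (i : Fin μ) : fox i (1 : GR μ k) = 0 := by
  simp [fox]

@[simp]
theorem fox_algebraMap (i : Fin μ) (a : k) : fox i (algebraMap k (GR μ k) a) = 0 := by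
  rw [Algebra.algebraMap_eq_smul_one, map_smul, fox_one, smul_zero]

theorem fox_gen_mul (i j : Fin μ) (x : GR μ k) :
    fox i (gen k j * x) = fox i x + if i = j then x else 0 := by
  simp only [fox, LinearMap.coe_mk, AddHom.coe_mk, map_mul, Module.End.mul_apply, foxHom_gen,
    foxHom_snd, mul_one, Pi.add_apply, Pi.single_apply]

theorem fox_genInv_mul (i j : Fin μ) (x : GR μ k) :
    fox i (genInv k j * x) = fox i x - if i = j then genInv k j * x else 0 := by
  simp only [fox, LinearMap.coe_mk, AddHom.coe_mk, map_mul, Module.End.mul_apply, foxHom_genInv,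
    foxHom_snd, mul_one, Pi.sub_apply, Pi.single_apply]

theorem fox_sum (i : Fin μ) (x : Fin μ → GR μ k) :
    fox i (∑ j, (gen k j - 1) * x j) = x i := by
  simp [sub_mul, fox_gen_mul, Finset.sum_add_distrib]

/-- The fundamental formula of Fox calculus. -/
theorem eq_aug_add_sum_fox (x : GR μ k) :
    x = algebraMap k (GR μ k) (aug μ k x) + ∑ i, (gen k i - 1) * fox i x := by
  induction x using induction_gen with
  | one => simp only [map_one, fox_one, mul_zero, Finset.sum_const_zero, add_zero]
  | add x y hx hy =>
    simp only [map_add, mul_add, Finset.sum_add_distrib]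
    nth_rw 1 [hx, hy]
    abel
  | smul a x hx =>
    simp only [aug_smul, map_mul, map_smul, mul_smul_comm, ← Finset.smul_sum]
    nth_rw 1 [hx]
    rw [smul_add, Algebra.smul_def a (algebraMap k (GR μ k) _)]
  | gen_mul j x hx =>
    have h : gen k j * x = (gen k j - 1) * x + x := by noncomm_ring
    simp only [fox_gen_mul, map_mul, aug_gen, one_mul, mul_add, Finset.sum_add_distrib,
      mul_ite, mul_zero, Finset.sum_ite_eq', Finset.mem_univ, if_true]
    rw [← add_assoc, ← hx, h, add_comm]
  | genInv_mul j x hx =>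
    have h : genInv k j * x = x - (gen k j - 1) * (genInv k j * x) := by
      rw [sub_mul, gen_mul_genInv_mul]; simp
    have ha : aug μ k (genInv k j) = 1 := by simp [genInv]
    simp only [fox_genInv_mul, map_mul, ha, one_mul, mul_sub, Finset.sum_sub_distrib,
      mul_ite, mul_zero, Finset.sum_ite_eq', Finset.mem_univ, if_true]
    rw [← add_sub_assoc, ← hx]
    exact h

/-- The span of all words of length at most `L`. -/
def wordBall (μ : ℕ) (k : Type*) [Field k] (L : ℕ) : Submodule k (GR μ k) :=
  Submodule.span k
    (Set.image (fun l : List (Fin μ × Bool) => of k (FG μ) (FreeGroup.mk l))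
      {l | l.length ≤ L})

theorem of_mk_mem_wordBall {L : ℕ} {l : List (Fin μ × Bool)} (hl : l.length ≤ L) :
    of k (FG μ) (FreeGroup.mk l) ∈ wordBall μ k L :=
  Submodule.subset_span ⟨l, hl, rfl⟩

theorem wordBall_mono : Monotone (wordBall μ k) := fun _ _ h =>
  Submodule.span_mono (Set.image_mono fun _ hl => le_trans hl h)

theorem one_mem_wordBall (L : ℕ) : (1 : GR μ k) ∈ wordBall μ k L := by
  simpa [one_def, FreeGroup.one_eq_mk] using of_mk_mem_wordBall (k := k) (L := L) (l := []) (by simp)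

theorem algebraMap_mem_wordBall (a : k) (L : ℕ) :
    algebraMap k (GR μ k) a ∈ wordBall μ k L := by
  rw [Algebra.algebraMap_eq_smul_one]
  exact Submodule.smul_mem _ _ (one_mem_wordBall L)

theorem exists_mem_wordBall (x : GR μ k) : ∃ L, x ∈ wordBall μ k L := by
  refine MonoidAlgebra.induction_on (motive := fun x => ∃ L, x ∈ wordBall μ k L) x
    (fun g => ?_) ?_ ?_
  · exact ⟨g.toWord.length, by
      simpa only [FreeGroup.mk_toWord] using
        of_mk_mem_wordBall (k := k) (l := g.toWord) le_rfl⟩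
  · rintro x y ⟨L, hx⟩ ⟨N, hy⟩
    exact ⟨max L N, add_mem (wordBall_mono (le_max_left _ _) hx)
      (wordBall_mono (le_max_right _ _) hy)⟩
  · rintro a x ⟨L, hx⟩
    exact ⟨L, Submodule.smul_mem _ _ hx⟩

theorem exists_forall_mem_wordBall {ι : Type*} [Finite ι] (x : ι → GR μ k) :
    ∃ L, ∀ i, x i ∈ wordBall μ k L := by
  choose L hL using fun i => exists_mem_wordBall (x i)
  obtain ⟨N, hN⟩ := (Set.finite_range L).bddAbove
  exact ⟨N, fun i => wordBall_mono (hN ⟨i, rfl⟩) (hL i)⟩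

theorem exists_eq_algebraMap_of_mem_wordBall_zero {x : GR μ k} (hx : x ∈ wordBall μ k 0) :
    ∃ a, x = algebraMap k (GR μ k) a := by
  induction hx using Submodule.span_induction with
  | mem x hx =>
    obtain ⟨l, hl, rfl⟩ := hx
    obtain rfl : l = [] := by simpa using hl
    exact ⟨1, by simp [FreeGroup.one_eq_mk]⟩
  | zero => exact ⟨0, by rw [map_zero]⟩
  | add x y _ _ hx hy =>
    obtain ⟨a, rfl⟩ := hx
    obtain ⟨b, rfl⟩ := hy
    exact ⟨a + b, by rw [map_add]⟩
  | smul c x _ hx =>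
    obtain ⟨a, rfl⟩ := hx
    exact ⟨c * a, by rw [map_mul, Algebra.smul_def]⟩

theorem of_mk_cons_true (j : Fin μ) (l : List (Fin μ × Bool)) :
    of k (FG μ) (FreeGroup.mk ((j, true) :: l)) = gen k j * of k (FG μ) (FreeGroup.mk l) := by
  rw [gen, ← map_mul, FreeGroup.of, FreeGroup.mul_mk, List.singleton_append]

theorem of_mk_cons_false (j : Fin μ) (l : List (Fin μ × Bool)) :
    of k (FG μ) (FreeGroup.mk ((j, false) :: l)) =
      genInv k j * of k (FG μ) (FreeGroup.mk l) := by
  rw [genInv, ← map_mul, FreeGroup.of, FreeGroup.inv_mk, FreeGroup.mul_mk]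
  rfl

theorem fox_of_mk_mem_wordBall (i : Fin μ) {L : ℕ} (l : List (Fin μ × Bool))
    (hl : l.length ≤ L) : fox i (of k (FG μ) (FreeGroup.mk l)) ∈ wordBall μ k L := by
  induction l with
  | nil => simp [← FreeGroup.one_eq_mk, ← one_def]
  | cons p l ih =>
    have hl' : l.length ≤ L := (Nat.le_succ _).trans hl
    obtain ⟨j, _ | _⟩ := p
    · rw [of_mk_cons_false, fox_genInv_mul, ← of_mk_cons_false]
      refine sub_mem (ih hl') ?_
      split_ifs
      exacts [of_mk_mem_wordBall hl, zero_mem _]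
    · rw [of_mk_cons_true, fox_gen_mul]
      refine add_mem (ih hl') ?_
      split_ifs
      exacts [of_mk_mem_wordBall hl', zero_mem _]

theorem fox_mem_wordBall (i : Fin μ) {L : ℕ} {x : GR μ k} (hx : x ∈ wordBall μ k L) :
    fox i x ∈ wordBall μ k L := by
  induction hx using Submodule.span_induction with
  | mem x hx =>
    obtain ⟨l, hl, rfl⟩ := hx
    exact fox_of_mk_mem_wordBall i l hl
  | zero => simp
  | add x y _ _ hx hy => rw [map_add]; exact add_mem hx hy
  | smul c x _ hx => rw [map_smul]; exact Submodule.smul_mem _ _ hx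

/-- A combination of second Fox derivatives that shortens words. -/
theorem fox_fox_add_mem_wordBall (i j : Fin μ) {L : ℕ} {x : GR μ k}
    (hx : x ∈ wordBall μ k (L + 1)) :
    fox j (fox i x) + (if j = i then fox i x else 0) ∈ wordBall μ k L := by
  have small : ∀ y ∈ wordBall μ k L, fox j y + (if j = i then y else 0) ∈ wordBall μ k L := by
    intro y hy
    refine add_mem (fox_mem_wordBall j hy) ?_
    split_ifs
    exacts [hy, zero_mem _]
  induction hx using Submodule.span_induction with
  | mem x hx =>
    obtain ⟨_ | ⟨⟨m, _ | _⟩, l⟩, hl, rfl⟩ := hx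
    · exact small _ (fox_of_mk_mem_wordBall i _ (by simp))
    · have hl' : l.length ≤ L := Nat.le_of_succ_le_succ hl
      have hw := of_mk_mem_wordBall (k := k) hl'
      have hi := fox_mem_wordBall i hw
      have hji := fox_mem_wordBall j hi
      have hj := fox_mem_wordBall j hw
      simp only [of_mk_cons_false, fox_genInv_mul, map_sub]
      by_cases him : i = m
      · subst him
        by_cases hij : j = i
        · subst hij
          simpa [fox_genInv_mul] using hji
        · simpa [fox_genInv_mul, hij] using sub_mem hji hj
      · simpa [him] using small _ hi
    · have hl' : l.length ≤ L := Nat.le_of_succ_le_succ hl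
      refine small _ ?_
      simp only [of_mk_cons_true, fox_gen_mul]
      refine add_mem (fox_of_mk_mem_wordBall i l hl') ?_
      split_ifs
      exacts [of_mk_mem_wordBall hl', zero_mem _]
  | zero => simp
  | add x y _ _ hx hy =>
    convert add_mem hx hy using 1
    split_ifs <;> simp only [map_add, add_zero] ; abel
  | smul c x _ hx =>
    convert Submodule.smul_mem _ c hx using 1
    split_ifs <;> simp

/-- A submodule stable under operators that differ from the Fox derivatives by constants is
contained in a submodule `L` as soon as its constants are, and its elements are determined by
their derivatives modulo `L`. -/
theorem le_of_stable {n : ℕ} (b : Fin μ → (Fin n → GR μ k) → Fin n → k)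
    (D : Fin μ → (Fin n → GR μ k) → Fin n → GR μ k)
    (hD : ∀ i p t, D i p t = fox i (p t) + algebraMap k (GR μ k) (b i p t))
    (K L : Submodule (GR μ k) (Fin n → GR μ k))
    (stable : ∀ i, ∀ p ∈ K, D i p ∈ K)
    (taylor : ∀ p ∈ K, p - ∑ i, (gen k i - 1) • D i p ∈ L)
    (const : ∀ c : Fin n → k, (fun t => algebraMap k (GR μ k) (c t)) ∈ K →
      (fun t => algebraMap k (GR μ k) (c t)) ∈ L) : K ≤ L := by
  have key : ∀ N, ∀ p ∈ K, (∀ t, p t ∈ wordBall μ k N) → p ∈ L := by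
    intro N
    induction N with
    | zero =>
      intro p hp hN
      choose c hc using fun t => exists_eq_algebraMap_of_mem_wordBall_zero (hN t)
      obtain rfl : p = fun t => algebraMap k (GR μ k) (c t) := funext hc
      exact const c hp
    | succ N ih =>
      intro p hp hN
      have hDL : ∀ i, D i p ∈ L := by
        intro i
        have hq := stable i p hp
        have he : ∀ j, D j (D i p) + (if j = i then D i p else 0) ∈ L := by
          intro j
          refine ih _ (add_mem (stable j _ hq) ?_) fun t => ?_
          · split_ifs
            exacts [hq, zero_mem _]
          · have h1 := fox_fox_add_mem_wordBall i j (hN t)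
            have h2 := algebraMap_mem_wordBall (μ := μ) (b j (D i p) t) N
            have h3 := algebraMap_mem_wordBall (μ := μ) (b i p t) N
            by_cases hij : j = i
            · subst hij
              convert add_mem h1 (add_mem h2 h3) using 1
              simp only [if_true, Pi.add_apply, hD, map_add, fox_algebraMap]
              abel
            · convert add_mem h1 h2 using 1
              simp only [hij, if_false, Pi.add_apply, hD, map_add, fox_algebraMap, add_zero,
                Pi.zero_apply]
        have hs : ∑ j, (gen k j - 1) • (D j (D i p) + (if j = i then D i p else 0)) ∈ L :=
          sum_mem fun j _ => L.smul_mem _ (he j)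
        have hg : gen k i • D i p ∈ L := by
          convert add_mem (taylor _ hq) hs using 1
          simp only [smul_add, Finset.sum_add_distrib, smul_ite, smul_zero, Finset.sum_ite_eq',
            Finset.mem_univ, if_true, sub_smul, one_smul]
          abel
        simpa [smul_smul] using L.smul_mem (genInv k i) hg
      have hs : ∑ i, (gen k i - 1) • D i p ∈ L := sum_mem fun i _ => L.smul_mem _ (hDL i)
      simpa using add_mem (taylor p hp) hs
  intro p hp
  obtain ⟨N, hN⟩ := exists_forall_mem_wordBall p
  exact key N p hp hN

/-- The Sato condition: every element of `M` is uniquely of the form `∑ i, (z_i - 1) m_i`. -/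
def IsSato (μ : ℕ) (k : Type*) [Field k] (M : Type*) [AddCommGroup M] [Module (GR μ k) M] :
    Prop :=
  Function.Bijective fun m : Fin μ → M => ∑ i, (gen k i - 1 : GR μ k) • m i

section Sato

variable {M M' : Type*} [AddCommGroup M] [Module (GR μ k) M] [AddCommGroup M']
  [Module (GR μ k) M']

theorem IsSato.eq_zero (hM : IsSato μ k M) {m : Fin μ → M}
    (h : ∑ i, (gen k i - 1 : GR μ k) • m i = 0) (i : Fin μ) : m i = 0 := by
  have h0 : m = 0 := hM.1 (by simpa using h)
  rw [h0, Pi.zero_apply]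

theorem isSato_of (h0 : ∀ m : Fin μ → M, ∑ i, (gen k i - 1 : GR μ k) • m i = 0 → ∀ i, m i = 0)
    (hs : ∀ x : M, ∃ m : Fin μ → M, ∑ i, (gen k i - 1 : GR μ k) • m i = x) : IsSato μ k M := by
  refine ⟨fun a b hab => ?_, hs⟩
  funext i
  refine sub_eq_zero.1 (h0 (fun i => a i - b i) ?_ i)
  simp only [smul_sub, Finset.sum_sub_distrib]
  exact sub_eq_zero.2 hab

theorem IsSato.ker (hM : IsSato μ k M) (hM' : IsSato μ k M') (f : M →ₗ[GR μ k] M') :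
    IsSato μ k (LinearMap.ker f) := by
  refine isSato_of (fun m hm i => ?_) fun x => ?_
  · refine Subtype.ext (hM.eq_zero (m := fun i => (m i : M)) ?_ i)
    simpa using congrArg Subtype.val hm
  · obtain ⟨m, hm⟩ := hM.2 (x : M)
    have h : ∀ i, f (m i) = 0 := hM'.eq_zero (by
      simpa only [map_sum, map_smul, LinearMap.mem_ker.1 x.2] using congrArg f hm)
    exact ⟨fun i => ⟨m i, h i⟩, Subtype.ext (by simpa using hm)⟩

theorem IsSato.range (hM : IsSato μ k M) (hM' : IsSato μ k M') (f : M →ₗ[GR μ k] M') :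
    IsSato μ k (LinearMap.range f) := by
  refine isSato_of (fun m hm i => ?_) ?_
  · refine Subtype.ext (hM'.eq_zero (m := fun i => (m i : M')) ?_ i)
    simpa using congrArg Subtype.val hm
  · rintro ⟨_, x, rfl⟩
    obtain ⟨m, hm⟩ := hM.2 x
    exact ⟨fun i => ⟨f (m i), m i, rfl⟩, Subtype.ext (by simp [← hm])⟩

theorem IsSato.quotient_range (hM : IsSato μ k M) (hM' : IsSato μ k M')
    (f : M →ₗ[GR μ k] M') : IsSato μ k (M' ⧸ LinearMap.range f) := by
  refine isSato_of (fun m hm i => ?_) fun x => ?_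
  · choose n hn using fun i => Submodule.mkQ_surjective (LinearMap.range f) (m i)
    have h : (LinearMap.range f).mkQ (∑ i, (gen k i - 1 : GR μ k) • n i) = 0 := by
      simpa only [map_sum, map_smul, hn] using hm
    obtain ⟨x, hx⟩ : ∑ i, (gen k i - 1 : GR μ k) • n i ∈ LinearMap.range f :=
      (Submodule.Quotient.mk_eq_zero _).1 h
    obtain ⟨y, rfl⟩ := hM.2 x
    have hy : (fun i => f (y i)) = n := hM'.1 (by simpa using hx)
    rw [← hn, ← hy]
    simp
  · obtain ⟨y, rfl⟩ := Submodule.mkQ_surjective _ x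
    obtain ⟨m, rfl⟩ := hM'.2 y
    exact ⟨fun i => (LinearMap.range f).mkQ (m i), by simp only [map_sum, map_smul]⟩

theorem augPi_aug {n : ℕ} (σ : (Fin n → GR μ k) →ₗ[GR μ k] (Fin n → GR μ k))
    (p : Fin n → GR μ k) (j : Fin n) :
    augPi μ k σ (fun t => aug μ k (p t)) j = aug μ k (σ p j) := by
  rw [augPi, LinearMap.pi_apply_eq_sum_univ σ p, LinearMap.pi_apply_eq_sum_univ σ]
  simp [Finset.sum_apply]

theorem aug_eq_zero_of_augPi_injective {n : ℕ}
    {σ : (Fin n → GR μ k) →ₗ[GR μ k] (Fin n → GR μ k)}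
    (hσ : Function.Injective (augPi μ k σ)) {p : Fin n → GR μ k}
    (hp : ∀ j, aug μ k (σ p j) = 0) (t : Fin n) : aug μ k (p t) = 0 := by
  have h : (fun t => aug μ k (p t)) = fun t => aug μ k ((0 : Fin n → GR μ k) t) := hσ <| by
    funext j
    rw [augPi_aug, augPi_aug, hp, map_zero, Pi.zero_apply, map_zero]
  simpa using congrFun h t

theorem eq_sum_fox {n : ℕ} {p : Fin n → GR μ k} (hp : ∀ t, aug μ k (p t) = 0) :
    p = ∑ i, (gen k i - 1) • fun t => fox i (p t) := by
  funext t
  have h := eq_aug_add_sum_fox (p t)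
  rw [hp, map_zero, zero_add] at h
  rw [Finset.sum_apply]
  exact h

theorem injective_of_augPi_injective {n : ℕ}
    {σ : (Fin n → GR μ k) →ₗ[GR μ k] (Fin n → GR μ k)}
    (hσ : Function.Injective (augPi μ k σ)) : Function.Injective σ := by
  have haug : ∀ p ∈ LinearMap.ker σ, ∀ t, aug μ k (p t) = 0 := fun p hp =>
    aug_eq_zero_of_augPi_injective hσ fun j => by simp [LinearMap.mem_ker.1 hp]
  rw [← LinearMap.ker_eq_bot, eq_bot_iff]
  refine le_of_stable 0 (fun i p t => fox i (p t)) (by simp) _ _ ?_ ?_ ?_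
  · intro i p hp
    have h := congrArg σ (eq_sum_fox (haug p hp))
    rw [LinearMap.mem_ker.1 hp, map_sum] at h
    simp only [map_smul] at h
    rw [LinearMap.mem_ker]
    funext t
    rw [← fox_sum i fun j => σ (fun t => fox j (p t)) t]
    have ht := congrFun h t
    simp only [Finset.sum_apply, Pi.smul_apply, smul_eq_mul] at ht
    rw [← ht, Pi.zero_apply, map_zero]
  · intro p hp
    rw [← eq_sum_fox (haug p hp), sub_self]
    exact zero_mem _
  · intro c hc
    have h : ∀ t, c t = 0 := fun t => by simpa using haug _ hc t
    simp only [h, map_zero]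
    exact zero_mem _

theorem isSato_of_isFlkField (h : IsFlkField μ k M) : IsSato μ k M := by
  obtain ⟨n, σ, π, -, hπ, hex, hσ⟩ := h
  have hπσ : ∀ q, π (σ q) = 0 := fun q => LinearMap.mem_ker.1 (hex ▸ LinearMap.mem_range_self σ q)
  refine isSato_of (fun m hm => ?_) fun x => ?_
  · choose p hp using fun i => hπ (m i)
    obtain ⟨q, hq⟩ : ∑ i, (gen k i - 1 : GR μ k) • p i ∈ LinearMap.range σ := by
      rw [hex, LinearMap.mem_ker, map_sum]
      simpa only [map_smul, hp] using hm
    have hq0 : ∀ t, aug μ k (q t) = 0 := aug_eq_zero_of_augPi_injective hσ.1 fun j => by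
      simp [hq, Finset.sum_apply]
    intro i
    suffices p i = σ fun t => fox i (q t) by rw [← hp, this, hπσ]
    rw [eq_sum_fox hq0, map_sum] at hq
    simp only [map_smul] at hq
    funext t
    have ht := congrArg (fox i) (congrFun hq t)
    simp only [Finset.sum_apply, Pi.smul_apply, smul_eq_mul, fox_sum] at ht
    exact ht.symm
  · obtain ⟨p, rfl⟩ := hπ x
    obtain ⟨c, hc⟩ := hσ.2 fun t => aug μ k (p t)
    set q := p - σ fun t => MonoidAlgebra.single 1 (c t) with hq
    have hq0 : ∀ t, aug μ k (q t) = 0 := fun t => by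
      rw [hq, Pi.sub_apply, map_sub, ← congrFun hc t, augPi, sub_self]
    refine ⟨fun i => π fun t => fox i (q t), ?_⟩
    have h := congrArg π (eq_sum_fox hq0)
    rw [hq, map_sub, hπσ, sub_zero, ← hq, map_sum] at h
    simpa only [map_smul] using h.symm

theorem finitePresentation_of_isFlkField (h : IsFlkField μ k M) :
    Module.FinitePresentation (GR μ k) M := by
  obtain ⟨n, σ, π, -, hπ, hex, -⟩ := h
  refine Module.finitePresentation_of_free_of_surjective π hπ ?_
  rw [← hex, LinearMap.range_eq_map]
  exact Module.Finite.fg_top.map σ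

theorem isFlkField_of_linearIndependent (hM : IsSato μ k M) {n : ℕ} (v : Fin n → M)
    (a : Fin μ → Fin n → Fin n → k) (hspan : Submodule.span (GR μ k) (Set.range v) = ⊤)
    (hv : ∀ l, ∑ i, (gen k i - 1 : GR μ k) • ∑ t, algebraMap k (GR μ k) (a i l t) • v t = v l)
    (hind : ∀ c : Fin n → k, ∑ t, algebraMap k (GR μ k) (c t) • v t = 0 → ∀ t, c t = 0) :
    IsFlkField μ k M := by
  let σ : (Fin n → GR μ k) →ₗ[GR μ k] (Fin n → GR μ k) :=
    Fintype.linearCombination (GR μ k) fun l =>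
      Pi.single l 1 - ∑ i, (gen k i - 1) • fun t => algebraMap k (GR μ k) (a i l t)
  let π : (Fin n → GR μ k) →ₗ[GR μ k] M := Fintype.linearCombination (GR μ k) v
  have hσ : ∀ p t, σ p t =
      p t - ∑ l, p l * ∑ i, (gen k i - 1) * algebraMap k (GR μ k) (a i l t) := by
    intro p t
    simp only [σ, Fintype.linearCombination_apply, Finset.sum_apply, Pi.smul_apply,
      Pi.sub_apply, smul_eq_mul, mul_sub, Finset.sum_sub_distrib, Pi.single_apply, mul_ite,
      mul_one, mul_zero, Finset.sum_ite_eq, Finset.mem_univ, if_true]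
  have hπσ : ∀ p, π (σ p) = 0 := by
    intro p
    rw [show σ p = ∑ l, p l • (_ : Fin n → GR μ k) from
      Fintype.linearCombination_apply (GR μ k) _ p, map_sum]
    simp only [π, map_sum, map_smul, map_sub]
    refine Finset.sum_eq_zero fun l _ => ?_
    rw [Fintype.linearCombination_apply_single, one_smul]
    simp only [Fintype.linearCombination_apply, hv, sub_self, smul_zero]
  have haug : augPi μ k σ = id := by
    funext c t
    simp [augPi, hσ]
  have hbij : Function.Bijective (augPi μ k σ) := haug ▸ Function.bijective_id
  refine ⟨n, σ, π, injective_of_augPi_injective hbij.1, ?_, le_antisymm ?_ ?_, hbij⟩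
  · rw [← LinearMap.range_eq_top, Fintype.range_linearCombination, hspan]
  · rintro _ ⟨p, rfl⟩
    exact hπσ p
  let b : Fin μ → (Fin n → GR μ k) → Fin n → k := fun i p t => ∑ l, aug μ k (p l) * a i l t
  let D : Fin μ → (Fin n → GR μ k) → Fin n → GR μ k := fun i p t =>
    fox i (p t) + algebraMap k (GR μ k) (b i p t)
  have taylor : ∀ p, p - ∑ i, (gen k i - 1) • D i p =
      σ fun t => algebraMap k (GR μ k) (aug μ k (p t)) := by
    intro p
    funext t
    rw [hσ, Pi.sub_apply]
    nth_rw 1 [eq_aug_add_sum_fox (p t)]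
    simp only [D, b, Finset.sum_apply, Pi.smul_apply, smul_eq_mul, mul_add,
      Finset.sum_add_distrib, map_sum, map_mul, Finset.mul_sum]
    rw [Finset.sum_comm, ← sub_sub, add_sub_cancel_right]
    congr 1
    refine Finset.sum_congr rfl fun l _ => Finset.sum_congr rfl fun i _ => ?_
    rw [← mul_assoc, ← mul_assoc, Algebra.commutes]
  refine le_of_stable b D (fun _ _ _ => rfl) _ _ ?_ ?_ ?_
  · intro i p hp
    have h := congrArg π (taylor p)
    rw [hπσ, map_sub, LinearMap.mem_ker.1 hp, zero_sub, neg_eq_zero, map_sum] at h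
    simp only [map_smul] at h
    exact hM.eq_zero h i
  · intro p _
    exact ⟨_, (taylor p).symm⟩
  · intro c hc
    have h := hind c (by simpa [π, Fintype.linearCombination_apply] using hc)
    simp only [h, map_zero]
    exact zero_mem _

/-- A finitely generated module satisfying the Sato condition contains a finite-dimensional
generating subspace `V` such that `V ⊆ ∑ i, (z_i - 1) V`. -/
theorem IsSato.exists_submodule [Module k M] [IsScalarTower k (GR μ k) M]
    [Module.Finite (GR μ k) M] (hM : IsSato μ k M) :
    ∃ V : Submodule k M, Module.Finite k V ∧ Submodule.span (GR μ k) (V : Set M) = ⊤ ∧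
      ∀ x ∈ V, ∃ m : Fin μ → M, (∀ i, m i ∈ V) ∧ ∑ i, (gen k i - 1 : GR μ k) • m i = x := by
  obtain ⟨n, s, hs⟩ := Module.Finite.exists_fin (R := GR μ k) (M := M)
  choose d hd using fun j => hM.2 (s j)
  have hr : ∀ x : M, ∃ r : Fin n → GR μ k, ∑ l, r l • s l = x := fun x =>
    Submodule.mem_span_range_iff_exists_fun _ |>.1 (hs ▸ Submodule.mem_top)
  choose r hr using hr
  obtain ⟨L, hL⟩ := exists_forall_mem_wordBall
    fun q : Fin n × Fin μ × Fin n => r (d q.1 q.2.1) q.2.2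
  let w : List (Fin μ × Bool) → GR μ k := fun l => of k (FG μ) (FreeGroup.mk l)
  let T : Set M := Set.image2 (fun l j => w l • s j) {l | l.length ≤ L} Set.univ
  have hT : T.Finite := (List.finite_length_le _ L).image2 _ Set.finite_univ
  have hball : ∀ j, ∀ x ∈ wordBall μ k L, x • s j ∈ Submodule.span k T := by
    intro j x hx
    induction hx using Submodule.span_induction with
    | mem x hx =>
      obtain ⟨l, hl, rfl⟩ := hx
      exact Submodule.subset_span ⟨l, hl, j, trivial, rfl⟩
    | zero => simp
    | add x y _ _ hx hy => rw [add_smul]; exact add_mem hx hy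
    | smul c x _ hx => rw [smul_assoc]; exact Submodule.smul_mem _ c hx
  have hdV : ∀ j i, d j i ∈ Submodule.span k T := by
    intro j i
    rw [← hr (d j i)]
    exact sum_mem fun l _ => hball l _ (hL (j, i, l))
  refine ⟨Submodule.span k T, FiniteDimensional.span_of_finite k hT, ?_, ?_⟩
  · rw [eq_top_iff, ← hs, Submodule.span_le]
    rintro _ ⟨j, rfl⟩
    refine Submodule.subset_span ?_
    simpa using hball j 1 (one_mem_wordBall L)
  · intro x hx
    induction hx using Submodule.span_induction with
    | mem x hx =>
      obtain ⟨l, hl, j, -, rfl⟩ := hx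
      refine ⟨fun i => aug μ k (w l) • d j i + fox i (w l) • s j, fun i => ?_, ?_⟩
      · exact add_mem (Submodule.smul_mem _ _ (hdV j i))
          (hball j _ (fox_of_mk_mem_wordBall i l hl))
      · have h : ∀ i, (gen k i - 1 : GR μ k) • aug μ k (w l) • d j i =
            algebraMap k (GR μ k) (aug μ k (w l)) • (gen k i - 1 : GR μ k) • d j i := by
          intro i
          rw [← algebraMap_smul (GR μ k) (aug μ k (w l)) (d j i), smul_smul, smul_smul,
            Algebra.commutes]
        simp only [smul_add, Finset.sum_add_distrib, h, ← Finset.smul_sum, hd]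
        conv_rhs => rw [eq_aug_add_sum_fox (w l), add_smul, Finset.sum_smul]
        simp only [mul_smul]
    | zero => exact ⟨0, by simp, by simp⟩
    | add x y _ _ hx hy =>
      obtain ⟨m, hm, rfl⟩ := hx
      obtain ⟨m', hm', rfl⟩ := hy
      exact ⟨m + m', fun i => add_mem (hm i) (hm' i), by simp [Finset.sum_add_distrib]⟩
    | smul c x _ hx =>
      obtain ⟨m, hm, rfl⟩ := hx
      refine ⟨c • m, fun i => Submodule.smul_mem _ c (hm i), ?_⟩
      rw [← algebraMap_smul (GR μ k) c (∑ i, _), Finset.smul_sum]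
      refine Finset.sum_congr rfl fun i _ => ?_
      rw [Pi.smul_apply, ← algebraMap_smul (GR μ k) c (m i), smul_smul, smul_smul,
        Algebra.commutes]

theorem IsSato.isFlkField [Module.Finite (GR μ k) M] (hM : IsSato μ k M) :
    IsFlkField μ k M := by
  let _ : Module k M := Module.compHom M (algebraMap k (GR μ k))
  have : IsScalarTower k (GR μ k) M := IsScalarTower.of_algebraMap_smul fun _ _ => rfl
  obtain ⟨V, hfin, hspan, hV⟩ := hM.exists_submodule
  let B := Module.finBasis k V
  choose m hm hmB using fun l => hV (B l) (B l).2
  have hB : ∀ c : Fin _ → k, ∑ t, algebraMap k (GR μ k) (c t) • (B t : M) =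
      ((∑ t, c t • B t : V) : M) := by
    intro c
    simp only [algebraMap_smul, Submodule.coe_sum, Submodule.coe_smul]
  refine isFlkField_of_linearIndependent hM (fun l => (B l : M))
    (fun i l t => B.repr ⟨m l i, hm l i⟩ t) ?_ ?_ ?_
  · rw [eq_top_iff, ← hspan, Submodule.span_le]
    intro x hx
    have h : x = ∑ t, algebraMap k (GR μ k) (B.repr ⟨x, hx⟩ t) • (B t : M) := by
      rw [hB, B.sum_repr]
    rw [h]
    exact sum_mem fun t _ => Submodule.smul_mem _ _ (Submodule.subset_span ⟨t, rfl⟩)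
  · intro l
    simp only [hB, B.sum_repr]
    exact hmB l
  · intro c hc
    rw [hB] at hc
    exact Fintype.linearIndependent_iff.1 B.linearIndependent c (Subtype.ext hc)

end Sato

end FreeGroupRing

/-- For a field `k` and a `k[F_μ]`-linear map `f : M → M'` between
`F_μ`-link modules, the kernel, image and cokernel of `f` are again `F_μ`-link modules. -/
theorem statement6 (μ : ℕ) (k : Type*) [Field k]
    (M M' : Type*) [AddCommGroup M] [Module (GR μ k) M] [AddCommGroup M']
    [Module (GR μ k) M']
    (hM : IsFlkField μ k M) (hM' : IsFlkField μ k M')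
    (f : M →ₗ[GR μ k] M') :
    IsFlkField μ k (LinearMap.ker f) ∧ IsFlkField μ k (LinearMap.range f) ∧
      IsFlkField μ k (M' ⧸ LinearMap.range f) := by
  have sM := FreeGroupRing.isSato_of_isFlkField hM
  have sM' := FreeGroupRing.isSato_of_isFlkField hM'
  have := FreeGroupRing.finitePresentation_of_isFlkField hM
  have := FreeGroupRing.finitePresentation_of_isFlkField hM'
  have hrange : IsFlkField μ k (LinearMap.range f) := (sM.range sM' f).isFlkField
  have := FreeGroupRing.finitePresentation_of_isFlkField hrange
  have : Module.Finite (GR μ k) (LinearMap.ker f) := Module.Finite.iff_fg.2 <| by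
    simpa using Module.FinitePresentation.fg_ker f.rangeRestrict f.surjective_rangeRestrict
  exact ⟨(sM.ker sM' f).isFlkField, hrange, (sM.quotient_range sM' f).isFlkField⟩
end
end
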